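/- Let 0 < q < 1 and suppose Gosper's duplication formulas hold for the parameter q, i.e. sin_q(2z) = S(q)·sin_{q²}(z)·cos_{q²}(z) and cos_q(2z) = cos_{q²}(z)² − sin_{q²}(z)² for all real z. Then sin_{q²}(π/8) = √( sin_q(π/4) · (√(S(q)² + 4) − S(q)) / (2 S(q)) ). -/

import Mathlib

open Real

/-- The infinite q-Pochhammer symbol `(x; q)_∞ = ∏_{n=0}^∞ (1 - x qⁿ)`. -/
noncomputable def qPoch (x q : ℝ) : ℝ := ∏' n : ℕ, (1 - x * q ^ n)

/-- Gosper's q-sine, as a function of its actual argument `w`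
(so `qSin q (π * z)` is `sin_q(π z)` from the paper). -/
noncomputable def qSin (q w : ℝ) : ℝ :=
  q ^ ((w / π - 1 / 2) ^ 2) * qPoch (q ^ (2 * (w / π))) (q ^ 2) *
    qPoch (q ^ (2 - 2 * (w / π))) (q ^ 2) / (qPoch q (q ^ 2)) ^ 2

/-- Gosper's q-cosine, as a function of its actual argument `w`. -/
noncomputable def qCos (q w : ℝ) : ℝ :=
  q ^ ((w / π) ^ 2) * qPoch (q ^ (1 - 2 * (w / π))) (q ^ 2) *
    qPoch (q ^ (1 + 2 * (w / π))) (q ^ 2) / (qPoch q (q ^ 2)) ^ 2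

/-- Gosper's constant `S(q) = q^{-1/4} (q²;q⁴)_∞⁴ / (q;q²)_∞²`. -/
noncomputable def gosperS (q : ℝ) : ℝ :=
  q ^ (-(1 / 4 : ℝ)) * (qPoch (q ^ 2) (q ^ 4)) ^ 4 / (qPoch q (q ^ 2)) ^ 2

/-- The q-Gamma function `Γ_q(z) = ((q;q)_∞ / (q^z;q)_∞) (1-q)^{1-z}`. -/
noncomputable def qGamma (q z : ℝ) : ℝ :=
  qPoch q q / qPoch (q ^ z) q * (1 - q) ^ (1 - z)

theorem qPoch_pos {x q : ℝ} (hx0 : 0 ≤ x) (hx1 : x < 1) (hq0 : 0 ≤ q) (hq1 : q < 1) :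
    0 < qPoch x q := by
  have hpos (n : ℕ) : 0 < 1 - x * q ^ n := by
    nlinarith [pow_le_one₀ (n := n) hq0 hq1.le]
  have hsum : Summable fun n : ℕ => -(x * q ^ n) :=
    ((summable_geometric_of_lt_one hq0 hq1).mul_left x).neg
  have hlog : Summable fun n : ℕ => Real.log (1 - x * q ^ n) := by
    simpa [sub_eq_add_neg] using Real.summable_log_one_add_of_summable hsum
  rw [qPoch, ← Real.rexp_tsum_eq_tprod hpos hlog]
  exact Real.exp_pos _

theorem gosperS_pos {q : ℝ} (hq0 : 0 < q) (hq1 : q < 1) : 0 < gosperS q := by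
  have hpow {n : ℕ} (hn : n ≠ 0) : q ^ n < 1 := pow_lt_one₀ hq0.le hq1 hn
  have h₁ := qPoch_pos hq0.le hq1 (sq_nonneg q) (hpow two_ne_zero)
  have h₂ := qPoch_pos (sq_nonneg q) (hpow two_ne_zero) (pow_nonneg hq0.le 4) (hpow four_ne_zero)
  unfold gosperS
  positivity

theorem qSin_pos {q w : ℝ} (hq0 : 0 < q) (hq1 : q < 1) (hw0 : 0 < w) (hwπ : w < π) :
    0 < qSin q w := by
  have hsq : q ^ 2 < 1 := pow_lt_one₀ hq0.le hq1 two_ne_zero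
  have hw : 0 < w / π := div_pos hw0 pi_pos
  have hw' : w / π < 1 := (div_lt_one pi_pos).2 hwπ
  have h₁ := qPoch_pos hq0.le hq1 (sq_nonneg q) hsq
  have hrpow {t : ℝ} (ht : 0 < t) : 0 < qPoch (q ^ t) (q ^ 2) :=
    qPoch_pos (rpow_nonneg hq0.le t) (rpow_lt_one hq0.le hq1 ht) (sq_nonneg q) hsq
  have h₂ := hrpow (t := 2 * (w / π)) (by linarith)
  have h₃ := hrpow (t := 2 - 2 * (w / π)) (by linarith)
  unfold qSin
  positivity

theorem qCos_pi_div_two_sub (q w : ℝ) : qCos q (π / 2 - w) = qSin q w := by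
  have h : (π / 2 - w) / π = 1 / 2 - w / π := by
    field_simp
  unfold qCos qSin
  rw [h, show 1 - 2 * (1 / 2 - w / π) = 2 * (w / π) by ring,
    show 1 + 2 * (1 / 2 - w / π) = 2 - 2 * (w / π) by ring,
    show (1 / 2 - w / π) ^ 2 = (w / π - 1 / 2) ^ 2 by ring]

/-- The positive solution of the system `S s c = a`, `c ^ 2 - s ^ 2 = a`. -/
theorem eq_sqrt_of_mul_eq_of_sq_sub_sq_eq {S a s c : ℝ} (hS : 0 < S) (ha : 0 ≤ a) (hs : 0 ≤ s)
    (hmul : a = S * s * c) (hsub : a = c ^ 2 - s ^ 2) :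
    s = √(a * (√(S ^ 2 + 4) - S) / (2 * S)) := by
  have hquad : (S * (2 * s ^ 2 + a)) ^ 2 = (a * √(S ^ 2 + 4)) ^ 2 := by
    rw [mul_pow a, Real.sq_sqrt (by positivity)]
    have hc : c ^ 2 = s ^ 2 + a := by linarith
    have ha2 : a ^ 2 = S ^ 2 * s ^ 2 * (s ^ 2 + a) := by
      rw [← hc, hmul]; ring
    linear_combination -4 * ha2
  have hroot : S * (2 * s ^ 2 + a) = a * √(S ^ 2 + 4) :=
    (pow_left_inj₀ (by positivity) (by positivity) two_ne_zero).1 hquad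
  rw [eq_comm, ← Real.sqrt_sq hs]
  congr 1
  field_simp
  linarith

/-- assuming Gosper's duplication formulas, the value at pi/8. -/
theorem qSin_eighth (q : ℝ) (hq0 : 0 < q) (hq1 : q < 1)
    (hsin : ∀ z : ℝ, qSin q (2 * z) = gosperS q * qSin (q ^ 2) z * qCos (q ^ 2) z)
    (hcos : ∀ z : ℝ, qCos q (2 * z) = qCos (q ^ 2) z ^ 2 - qSin (q ^ 2) z ^ 2) :
    qSin (q ^ 2) (π / 8) =
      Real.sqrt (qSin q (π / 4) *
        (Real.sqrt (gosperS q ^ 2 + 4) - gosperS q) / (2 * gosperS q)) := by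
  have hsq : q ^ 2 < 1 := pow_lt_one₀ hq0.le hq1 two_ne_zero
  have harg : 2 * (π / 8) = π / 4 := by ring
  have hsin' := hsin (π / 8)
  have hcos' := hcos (π / 8)
  have hsymm : qCos q (π / 4) = qSin q (π / 4) := by
    rw [← qCos_pi_div_two_sub, show π / 2 - π / 4 = π / 4 by ring]
  rw [harg] at hsin' hcos'
  rw [hsymm] at hcos'
  exact eq_sqrt_of_mul_eq_of_sq_sub_sq_eq (gosperS_pos hq0 hq1)
    (qSin_pos hq0 hq1 (by positivity) (by linarith [pi_pos])).le
    (qSin_pos (by positivity) hsq (by positivity) (by linarith [pi_pos])).le hsin' hcos'
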